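/- arXiv:1102.2580 — 3 statements merged into one kernel-verified Lean document; each statement's English description precedes it below -/
import Mathlib

section
/- Let d ≥ 1 and d_1 ≥ 1 be integers, and let s ≥ 0 be an integer. Let Q(x,y) be a nonzero complex polynomial in two variables of total degree at most d, let x_0 ∈ ℂ, R > 0, and let h be holomorphic on the open disk D_R(x_0) = {x : |x−x_0| < R} with Q(x,h(x)) = 0 for all x ∈ D_R(x_0). Let P(x,y) be a complex polynomial of total degree at most d_1 and set g̃(x) = P(x,h(x)). Then for every complex polynomial W(x) of degree at most s such that g̃ − W is not identically zero on D_R(x_0), the equation g̃(x) = W(x) has at most d·max(s,d_1) solutions in D_R(x_0); that is, g̃ is (s, d·max(s,d_1))-valent in D_R(x_0) among non-degenerate comparisons. -/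
open Metric Set


noncomputable section

def idxEquiv (k : ℕ) : {n : Fin 2 →₀ ℕ | (n.sum fun _ e => e) ≤ k} ≃ (Σ i : Fin (k+1), Fin (k+1-i)) where
  toFun n := ⟨⟨n.1 0, by
    have := n.2
    simp only [Set.mem_ofPred_eq] at this
    rw [Finsupp.sum_fintype _ _ (by simp)] at this
    simp at this; omega⟩, ⟨n.1 1, by
    have := n.2
    simp only [Set.mem_ofPred_eq] at this
    rw [Finsupp.sum_fintype _ _ (by simp)] at this
    simp at this ⊢; omega⟩⟩
  invFun p := ⟨Finsupp.equivFunOnFinite.symm ![p.1, p.2], by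
    obtain ⟨⟨i, hi⟩, ⟨j, hj⟩⟩ := p
    simp only [Set.mem_ofPred_eq]
    rw [Finsupp.sum_fintype _ _ (by simp)]
    simp at hj ⊢; omega⟩
  left_inv n := by
    ext i
    fin_cases i <;> simp
  right_inv p := by
    obtain ⟨⟨i, hi⟩, ⟨j, hj⟩⟩ := p
    simp

lemma finrank_V (k : ℕ) :
    2 * Module.finrank ℂ (MvPolynomial.restrictTotalDegree (Fin 2) ℂ k) = (k+1)*(k+2) := by
  have h := Module.finrank_eq_nat_card_basis (MvPolynomial.basisRestrictSupport ℂ {n : Fin 2 →₀ ℕ | (n.sum fun _ e => e) ≤ k})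
  rw [Nat.card_congr (idxEquiv k)] at h
  have h' : Module.finrank ℂ (MvPolynomial.restrictTotalDegree (Fin 2) ℂ k) = _ := h
  rw [h', Nat.card_eq_fintype_card, Fintype.card_sigma]
  simp only [Fintype.card_fin]
  rw [Fin.sum_univ_eq_sum_range (fun i => k+1-i)]
  clear h h'
  have := Finset.sum_range_reflect (fun i => i+1) (k+1)
  have h2 : ∑ i ∈ Finset.range (k+1), (k+1-i) = ∑ i ∈ Finset.range (k+1), (i+1) := by
    rw [← this]; apply Finset.sum_congr rfl; intro i hi; simp at hi; omega
  rw [h2]; clear h2 this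
  induction k with
  | zero => simp
  | succ k ih => rw [Finset.sum_range_succ, mul_add, ih]; ring

lemma totalDegree_aeval_X0 (W : Polynomial ℂ) :
    (Polynomial.aeval (MvPolynomial.X 0 : MvPolynomial (Fin 2) ℂ) W).totalDegree ≤ W.natDegree := by
  rw [Polynomial.aeval_eq_sum_range]
  apply MvPolynomial.totalDegree_finsetSum_le
  intro i hi
  refine (MvPolynomial.totalDegree_smul_le _ _).trans ?_
  simp at hi ⊢; omega

lemma eval_aeval_X0 (W : Polynomial ℂ) (v : Fin 2 → ℂ) :
    MvPolynomial.eval v (Polynomial.aeval (MvPolynomial.X 0 : MvPolynomial (Fin 2) ℂ) W) = W.eval (v 0) := by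
  rw [← MvPolynomial.coe_aeval_eq_eval, RingHom.coe_coe, ← Polynomial.aeval_algHom_apply]
  simp [Polynomial.aeval_def, Polynomial.eval₂_eq_eval_map]

lemma bezout_aux (q T : MvPolynomial (Fin 2) ℂ) (hq : Prime q) (hqT : ¬ q ∣ T)
    (h : ℂ → ℂ) (S : Finset ℂ) (hS : ∀ x ∈ S, MvPolynomial.eval ![x, h x] q = 0)
    (hS' : ∀ x ∈ S, MvPolynomial.eval ![x, h x] T = 0) :
    S.card ≤ q.totalDegree * T.totalDegree := by
  classical
  have hT0 : T ≠ 0 := fun e => hqT (e ▸ dvd_zero q)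
  set a := q.totalDegree with ha
  set b := T.totalDegree with hb
  set N := S.card with hN
  let V := MvPolynomial.restrictTotalDegree (Fin 2) ℂ
  have memV : ∀ k p, p ∈ V k ↔ p.totalDegree ≤ k := fun k p =>
    MvPolynomial.mem_restrictTotalDegree _ _ _
  let E₀ : MvPolynomial (Fin 2) ℂ →ₗ[ℂ] (S → ℂ) :=
    LinearMap.pi fun x => (MvPolynomial.aeval ![(x : ℂ), h x]).toLinearMap
  have hE₀ : ∀ p x, E₀ p x = MvPolynomial.eval ![(x : ℂ), h x] p := by
    intro p x; simp [E₀, MvPolynomial.aeval_eq_eval]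
  let E := E₀.domRestrict (V (N + a + b))
  have hEsurj : Function.Surjective E := by
    intro r
    let r' : ℂ → ℂ := fun x => if hx : x ∈ S then r ⟨x, hx⟩ else 0
    let L := Lagrange.interpolate S id r'
    have hinj : Set.InjOn (id : ℂ → ℂ) S := Set.injOn_id _
    have hL : L.natDegree ≤ N :=
      Polynomial.natDegree_le_of_degree_le (Lagrange.degree_interpolate_lt r' hinj).le
    refine ⟨⟨Polynomial.aeval (MvPolynomial.X 0) L, ?_⟩, ?_⟩
    · rw [memV]
      have := totalDegree_aeval_X0 L
      omega
    · funext x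
      rw [LinearMap.domRestrict_apply, hE₀, eval_aeval_X0]
      have := Lagrange.eval_interpolate_at_node r' hinj x.2
      simpa [L, r'] using this
  let φ₀ : (V (N + b) × V (N + a)) →ₗ[ℂ] MvPolynomial (Fin 2) ℂ :=
    ((LinearMap.mulLeft ℂ q).domRestrict _).coprod ((LinearMap.mulLeft ℂ T).domRestrict _)
  have hφ₀ : ∀ u, φ₀ u = q * u.1 + T * u.2 := by intro u; simp [φ₀]
  have hφmem : ∀ u, φ₀ u ∈ V (N + a + b) := by
    intro u
    rw [hφ₀]
    have h1 := (memV _ _).1 u.1.2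
    have h2 := (memV _ _).1 u.2.2
    refine Submodule.add_mem _ ?_ ?_ <;> rw [memV] <;>
    refine (MvPolynomial.totalDegree_mul _ _).trans ?_ <;> omega
  let φ := φ₀.codRestrict _ hφmem
  have hrange : LinearMap.range φ ≤ LinearMap.ker E := by
    rintro _ ⟨u, rfl⟩
    rw [LinearMap.mem_ker]
    funext x
    rw [LinearMap.domRestrict_apply, hE₀, LinearMap.codRestrict_apply, hφ₀]
    simp [hS x x.2, hS' x x.2]
  -- kernel
  let ψ₀ : LinearMap.ker φ →ₗ[ℂ] MvPolynomial (Fin 2) ℂ :=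
    (V (N+a)).subtype ∘ₗ LinearMap.snd ℂ _ _ ∘ₗ (LinearMap.ker φ).subtype
  let μ : V N →ₗ[ℂ] MvPolynomial (Fin 2) ℂ := (LinearMap.mulLeft ℂ q).domRestrict _
  have hker : ∀ u : LinearMap.ker φ, q * u.1.1 + T * u.1.2 = 0 := by
    intro u
    have := congrArg Subtype.val (LinearMap.mem_ker.1 u.2)
    rwa [LinearMap.codRestrict_apply, hφ₀] at this
  have hψinj : Function.Injective ψ₀ := by
    rw [injective_iff_map_eq_zero]
    intro u hu
    have hu' : (u.1.2 : MvPolynomial (Fin 2) ℂ) = 0 := hu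
    have h1 := hker u
    rw [hu', mul_zero, add_zero] at h1
    have h2 := (mul_eq_zero.1 h1).resolve_left hq.ne_zero
    ext1
    exact Prod.ext (Subtype.ext h2) (Subtype.ext hu')
  have hψrange : LinearMap.range ψ₀ ≤ LinearMap.range μ := by
    rintro _ ⟨u, rfl⟩
    have h1 := hker u
    have hd : q ∣ T * u.1.2 := ⟨-u.1.1, by linear_combination h1⟩
    obtain ⟨w, hw⟩ := (hq.dvd_or_dvd hd).resolve_left hqT
    refine ⟨⟨w, ?_⟩, ?_⟩
    · rw [memV]
      by_cases hw0 : w = 0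
      · simp [hw0]
      have h2 := (memV _ _).1 u.1.2.2
      rw [hw, MvPolynomial.totalDegree_mul_of_isDomain hq.ne_zero hw0] at h2
      omega
    · simp [μ, ψ₀, hw]
  have f1 : Module.finrank ℂ (LinearMap.ker φ) ≤ Module.finrank ℂ (V N) := by
    rw [← LinearMap.finrank_range_of_inj hψinj]
    exact (Submodule.finrank_mono hψrange).trans (LinearMap.finrank_range_le μ)
  have f2 := LinearMap.finrank_range_add_finrank_ker φ
  have f3 := LinearMap.finrank_range_add_finrank_ker E
  rw [LinearMap.range_eq_top.2 hEsurj, finrank_top, Module.finrank_fintype_fun_eq_card,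
    Fintype.card_coe, ← hN] at f3
  rw [Module.finrank_prod] at f2
  have f4 := Submodule.finrank_mono hrange
  have d1 := finrank_V N
  have d2 := finrank_V (N + a)
  have d3 := finrank_V (N + b)
  have d4 := finrank_V (N + a + b)
  change 2 * Module.finrank ℂ (V _) = _ at d1 d2 d3 d4
  nlinarith

lemma diff_eval (h : ℂ → ℂ) (U : Set ℂ) (hh : DifferentiableOn ℂ h U)
    (p : MvPolynomial (Fin 2) ℂ) :
    DifferentiableOn ℂ (fun x => MvPolynomial.eval ![x, h x] p) U := by
  induction p using MvPolynomial.induction_on with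
  | C c => simp
  | add p q hp hq => simp only [map_add]; exact hp.add hq
  | mul_X p i hp =>
    simp only [map_mul, MvPolynomial.eval_X]
    refine hp.mul ?_
    fin_cases i
    · exact differentiableOn_id
    · exact hh

lemma exists_prime_factor (x₀ : ℂ) (R : ℝ) (hR : 0 < R) (h : ℂ → ℂ)
    (hh : DifferentiableOn ℂ h (Metric.ball x₀ R)) (Q : MvPolynomial (Fin 2) ℂ) :
    Q ≠ 0 → (∀ x ∈ Metric.ball x₀ R, MvPolynomial.eval ![x, h x] Q = 0) →
    ∃ q, Prime q ∧ q ∣ Q ∧ ∀ x ∈ Metric.ball x₀ R, MvPolynomial.eval ![x, h x] q = 0 := by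
  induction Q using UniqueFactorizationMonoid.induction_on_prime with
  | h₁ => intro h0; exact absurd rfl h0
  | h₂ u hu =>
    intro _ h0
    have := (hu.map (MvPolynomial.eval ![x₀, h x₀])).ne_zero
    exact absurd (h0 x₀ (mem_ball_self hR)) this
  | h₃ A p hA hp ih =>
    intro _ h0
    have anp := (diff_eval h _ hh p).analyticOnNhd isOpen_ball
    have anA := (diff_eval h _ hh A).analyticOnNhd isOpen_ball
    have key := anp.eq_zero_or_eq_zero_of_mul_eq_zero anA (fun x hx => by simpa using h0 x hx)
      (convex_ball x₀ R).isPreconnected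
    rcases key with k | k
    · exact ⟨p, hp, dvd_mul_right _ _, k⟩
    · obtain ⟨q, h1, h2, h3⟩ := ih hA k
      exact ⟨q, h1, h2.mul_left _, h3⟩

end

/-- A regular branch `g̃(x) = P(x, h(x))` of a polynomial restricted to the algebraic
curve `Q(x,y) = 0` is `(s, d·max(s,d₁))`-valent on `D_R(x₀)` among non-degenerate
comparisons: for every polynomial `W` of degree at most `s` such that `g̃ - W` is not
identically zero on `D_R(x₀)`, the equation `g̃ x = W x` has at most `d·max(s,d₁)`
solutions in `D_R(x₀)`. -/
theorem branch_sp_valent (d d₁ s : ℕ) (hd : 1 ≤ d) (hd₁ : 1 ≤ d₁)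
    (Q : MvPolynomial (Fin 2) ℂ) (hQ : Q ≠ 0) (hQdeg : Q.totalDegree ≤ d)
    (x₀ : ℂ) (R : ℝ) (hR : 0 < R) (h : ℂ → ℂ)
    (hh : DifferentiableOn ℂ h (Metric.ball x₀ R))
    (hQh : ∀ x ∈ Metric.ball x₀ R, MvPolynomial.eval ![x, h x] Q = 0)
    (P : MvPolynomial (Fin 2) ℂ) (hPdeg : P.totalDegree ≤ d₁)
    (g : ℂ → ℂ) (hgdef : ∀ x ∈ Metric.ball x₀ R, g x = MvPolynomial.eval ![x, h x] P) :
    ∀ W : Polynomial ℂ, W.natDegree ≤ s →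
      (∃ x ∈ Metric.ball x₀ R, g x ≠ W.eval x) →
      {x | x ∈ Metric.ball x₀ R ∧ g x = W.eval x}.encard ≤ ((d * max s d₁ : ℕ) : ℕ∞) := by
  intro W hW ⟨x₁, hx₁, hne⟩
  obtain ⟨q, hq, ⟨c, hc⟩, hqh⟩ := exists_prime_factor x₀ R hR h hh Q hQ hQh
  set T := P - Polynomial.aeval (MvPolynomial.X 0) W with hT
  have hTe : ∀ x ∈ Metric.ball x₀ R, MvPolynomial.eval ![x, h x] T = g x - W.eval x := by
    intro x hx
    rw [hT, map_sub, eval_aeval_X0, hgdef x hx]; simp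
  have hqT : ¬ q ∣ T := by
    rintro ⟨e, he⟩
    have := hTe x₁ hx₁
    rw [he, map_mul, hqh x₁ hx₁, zero_mul] at this
    exact hne (sub_eq_zero.1 this.symm)
  have hTd : T.totalDegree ≤ max s d₁ := by
    refine (MvPolynomial.totalDegree_sub _ _).trans ?_
    have := totalDegree_aeval_X0 W
    omega
  have hqd : q.totalDegree ≤ d := by
    have hc0 : c ≠ 0 := by rintro rfl; simp at hc; exact hQ hc
    rw [hc, MvPolynomial.totalDegree_mul_of_isDomain hq.ne_zero hc0] at hQdeg
    omega
  by_contra hcon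
  rw [not_le] at hcon
  obtain ⟨t, ht, hcard⟩ := Set.exists_subset_encard_eq (Order.add_one_le_of_lt hcon)
  have htf : t.Finite := Set.finite_of_encard_eq_coe (k := d * max s d₁ + 1) (by rw [hcard]; push_cast; rfl)
  have := bezout_aux q T hq hqT h htf.toFinset
    (fun x hx => hqh x (ht (by simpa using hx)).1)
    (fun x hx => by
      have hx' := ht (by simpa using hx : x ∈ t)
      rw [hTe x hx'.1, hx'.2, sub_self])
  rw [htf.encard_eq_coe_toFinset_card] at hcard
  have h2 : htf.toFinset.card = d * max s d₁ + 1 := by exact_mod_cast hcard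
  have h3 := Nat.mul_le_mul hqd hTd
  omega
end

section
/- Let d be a positive integer and let Z be a nonempty subset of the closed unit disk {z ∈ ℂ : |z| ≤ 1}. Then (1/4)·ω_{cd}(Z) ≤ c_d(Z) ≤ ρ_d(Z). -/
open Metric Set

/-- `cdisk d Z` is the infimum, over all families of `d` closed disks
`D(z 1, r 1), …, D(z d, r d)` in `ℂ` whose union contains `Z`, of the sum
`r 1 + ⋯ + r d` of their radii. -/
noncomputable def cdisk (d : ℕ) (Z : Set ℂ) : ℝ :=
  sInf { t : ℝ | ∃ (z : Fin d → ℂ) (r : Fin d → ℝ),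
    (∀ i, 0 ≤ r i) ∧ Z ⊆ (⋃ i, Metric.closedBall (z i) (r i)) ∧ t = ∑ i, r i }

/-- `coveringNumber ε Z` is the minimal number of closed disks of radius `ε`
needed to cover `Z`. -/
noncomputable def coveringNumber (ε : ℝ) (Z : Set ℂ) : ℕ :=
  sInf { n : ℕ | ∃ c : Fin n → ℂ, Z ⊆ ⋃ i, Metric.closedBall (c i) ε }

/-- `ωcd d Z = sup_{ε > 0} ε · (max (M(ε,Z) - d) 0)^(1/2)`. -/
noncomputable def ωcd (d : ℕ) (Z : Set ℂ) : ℝ :=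
  sSup { t : ℝ | ∃ ε : ℝ, 0 < ε ∧
    t = ε * Real.sqrt (max ((coveringNumber ε Z : ℝ) - d) 0) }

/-- `ρd d Z = d · ε₀`, where `ε₀` is the infimum of the `ε > 0` such that `Z` can be
covered by `d` closed disks of radius `ε`. -/
noncomputable def ρd (d : ℕ) (Z : Set ℂ) : ℝ :=
  d * sInf { ε : ℝ | 0 < ε ∧ ∃ c : Fin d → ℂ, Z ⊆ ⋃ i, Metric.closedBall (c i) ε }

/-- A cover by a finset of centres bounds the covering number. -/
lemma coveringNumber_le_card (ε : ℝ) (Z : Set ℂ) (F : Finset ℂ)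
    (h : ∀ z ∈ Z, ∃ c ∈ F, dist z c ≤ ε) : coveringNumber ε Z ≤ F.card := by
  unfold _root_.coveringNumber
  apply Nat.sInf_le
  refine ⟨fun i => (F.equivFin.symm i : ℂ), fun z hz => ?_⟩
  obtain ⟨c, hc, hzc⟩ := h z hz
  refine Set.mem_iUnion.2 ⟨F.equivFin ⟨c, hc⟩, ?_⟩
  simpa using hzc

/-- A disk of radius `r` is covered by at most `1 + 16 (r/ε)^2` disks of radius `ε`. -/
lemma disk_cover (ε r : ℝ) (hε : 0 < ε) (hr : 0 ≤ r) (c : ℂ) :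
    ∃ F : Finset ℂ, (F.card : ℝ) ≤ 1 + 16 * (r / ε) ^ 2 ∧
      ∀ z ∈ Metric.closedBall c r, ∃ w ∈ F, dist z w ≤ ε := by
  by_cases hre : r ≤ ε
  · refine ⟨{c}, ?_, fun z hz => ⟨c, by simp, ?_⟩⟩
    · have : 0 ≤ (r / ε) ^ 2 := sq_nonneg _
      simp only [Finset.card_singleton, Nat.cast_one]
      linarith
    · exact le_trans (Metric.mem_closedBall.1 hz) hre
  · push Not at hre
    have hx : 1 ≤ r / ε := (one_le_div hε).2 hre.le
    set n : ℕ := ⌊2 * r / ε⌋₊ + 1 with hn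
    let g : ℕ × ℕ → ℂ := fun p =>
      c + ⟨-r + (p.1 + 1 / 2) * ε, -r + (p.2 + 1 / 2) * ε⟩
    have key : ∀ t : ℝ, |t| ≤ r →
        ∃ k ∈ Finset.range n, |t - (-r + ((k : ℝ) + 1 / 2) * ε)| ≤ ε / 2 := by
      intro t ht
      obtain ⟨h1, h2⟩ := abs_le.1 ht
      have h0 : 0 ≤ (t + r) / ε := div_nonneg (by linarith) hε.le
      refine ⟨⌊(t + r) / ε⌋₊, ?_, ?_⟩
      · rw [Finset.mem_range, hn]
        apply Nat.lt_succ_of_le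
        apply Nat.floor_le_floor
        apply div_le_div_of_nonneg_right _ hε.le
        linarith
      · have h3 := Nat.floor_le h0
        have h4 := Nat.lt_floor_add_one ((t + r) / ε)
        rw [le_div_iff₀ hε] at h3
        rw [div_lt_iff₀ hε] at h4
        rw [abs_le]
        constructor <;> linarith
    refine ⟨((Finset.range n) ×ˢ (Finset.range n)).image g, ?_, fun z hz => ?_⟩
    · have h1 : ((((Finset.range n) ×ˢ (Finset.range n)).image g).card : ℝ) ≤ (n : ℝ) * n := by
        have := Finset.card_image_le (s := (Finset.range n) ×ˢ (Finset.range n)) (f := g)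
        rw [Finset.card_product, Finset.card_range] at this
        exact_mod_cast this
      have h2 : (n : ℝ) ≤ 2 * (r / ε) + 1 := by
        have := Nat.floor_le (a := 2 * r / ε) (by positivity)
        rw [hn]
        push_cast
        rw [← mul_div_assoc]
        linarith
      have h3 : (0 : ℝ) ≤ n := Nat.cast_nonneg n
      nlinarith
    · have hz' : ‖z - c‖ ≤ r := by simpa [dist_eq_norm] using hz
      obtain ⟨k, hk, hk'⟩ := key (z - c).re ((Complex.abs_re_le_norm _).trans hz')
      obtain ⟨l, hl, hl'⟩ := key (z - c).im ((Complex.abs_im_le_norm _).trans hz')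
      refine ⟨g (k, l), Finset.mem_image_of_mem _ (Finset.mk_mem_product hk hl), ?_⟩
      rw [dist_eq_norm]
      refine (Complex.norm_le_abs_re_add_abs_im _).trans ?_
      have e1 : (z - g (k, l)).re = (z - c).re - (-r + ((k : ℝ) + 1 / 2) * ε) := by
        simp only [g, Complex.sub_re, Complex.add_re]; ring
      have e2 : (z - g (k, l)).im = (z - c).im - (-r + ((l : ℝ) + 1 / 2) * ε) := by
        simp only [g, Complex.sub_im, Complex.add_im]; ring
      rw [e1, e2]
      linarith

/-- For a nonempty subset `Z` of the closed unit disk,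
`(1/4)·ωcd d Z ≤ cdisk d Z ≤ ρd d Z`. -/
theorem omega_le_cdisk_le_rho (d : ℕ) (hd : 0 < d) (Z : Set ℂ) (hne : Z.Nonempty)
    (hZ : Z ⊆ Metric.closedBall (0 : ℂ) 1) :
    (1 / 4 : ℝ) * ωcd d Z ≤ cdisk d Z ∧ cdisk d Z ≤ ρd d Z := by
  classical
  constructor
  · suffices h : ωcd d Z ≤ 4 * cdisk d Z by linarith
    unfold ωcd
    refine csSup_le ⟨_, 1, one_pos, rfl⟩ ?_
    rintro t ⟨ε, hε, rfl⟩
    suffices h : ε * Real.sqrt (max ((coveringNumber ε Z : ℝ) - d) 0) / 4 ≤ cdisk d Z by linarith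
    unfold cdisk
    refine le_csInf ⟨_, fun _ => 0, fun _ => 1, fun _ => zero_le_one, fun z hz =>
      Set.mem_iUnion.2 ⟨⟨0, hd⟩, hZ hz⟩, rfl⟩ ?_
    rintro t ⟨z, r, hr, hcov, rfl⟩
    choose F hF1 hF2 using fun i => disk_cover ε (r i) hε (hr i) (z i)
    have hS : 0 ≤ ∑ i, r i := Finset.sum_nonneg fun i _ => hr i
    have hM : (coveringNumber ε Z : ℝ) ≤ d + 16 * ((∑ i, r i) / ε) ^ 2 := by
      have h1 : coveringNumber ε Z ≤ ∑ i, (F i).card := by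
        refine (coveringNumber_le_card ε Z (Finset.univ.biUnion F) ?_).trans
          Finset.card_biUnion_le
        intro w hw
        obtain ⟨i, hi⟩ := Set.mem_iUnion.1 (hcov hw)
        obtain ⟨c, hc, hc'⟩ := hF2 i w hi
        exact ⟨c, Finset.mem_biUnion.2 ⟨i, Finset.mem_univ _, hc⟩, hc'⟩
      have h2 : (coveringNumber ε Z : ℝ) ≤ ∑ i, ((F i).card : ℝ) := by exact_mod_cast h1
      have h3 : ∑ i, ((F i).card : ℝ) ≤ ∑ i, (1 + 16 * (r i / ε) ^ 2) :=
        Finset.sum_le_sum fun i _ => hF1 i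
      have h4 : ∑ i, (r i / ε) ^ 2 ≤ (∑ i, r i / ε) ^ 2 :=
        Finset.sum_sq_le_sq_sum_of_nonneg fun i _ => div_nonneg (hr i) hε.le
      rw [Finset.sum_add_distrib, ← Finset.mul_sum] at h3
      rw [← Finset.sum_div] at h4
      simp only [Finset.sum_const, Finset.card_univ, Fintype.card_fin, nsmul_eq_mul,
        mul_one] at h3
      linarith
    have hs : Real.sqrt (max ((coveringNumber ε Z : ℝ) - d) 0) ≤ 4 * ((∑ i, r i) / ε) := by
      apply Real.sqrt_le_iff.2
      refine ⟨by positivity, max_le ?_ (by positivity)⟩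
      nlinarith
    have := mul_le_mul_of_nonneg_left hs hε.le
    have e : ε * (4 * ((∑ i, r i) / ε)) = 4 * ∑ i, r i := by field_simp
    linarith
  · have hd' : (0 : ℝ) < d := Nat.cast_pos.2 hd
    suffices h : cdisk d Z / d ≤
        sInf { ε : ℝ | 0 < ε ∧ ∃ c : Fin d → ℂ, Z ⊆ ⋃ i, Metric.closedBall (c i) ε } by
      unfold ρd
      rwa [div_le_iff₀' hd'] at h
    refine le_csInf ⟨1, one_pos, fun _ => 0, fun z hz =>
      Set.mem_iUnion.2 ⟨⟨0, hd⟩, hZ hz⟩⟩ ?_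
    rintro ε ⟨hε, c, hc⟩
    rw [div_le_iff₀' hd']
    unfold cdisk
    refine csInf_le ⟨0, ?_⟩ ⟨c, fun _ => ε, fun _ => hε.le, hc, by simp⟩
    rintro t ⟨z, r, hr, -, rfl⟩
    exact Finset.sum_nonneg fun i _ => hr i
end

section
/- Let d be a positive integer, let P be a real polynomial of degree d, and let Z ⊆ [−1,1] be such that ω = ω_d(Z) satisfies 0 < ω ≤ 2. Then sup_{x ∈ [−1,1]} |P(x)| ≤ T_d((4−ω)/ω) · sup_{x ∈ Z} |P(x)|, where T_d is the d-th Chebyshev polynomial of the first kind. -/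
open Metric Set

/-- `intervalCoveringNumber Z ε` is the minimal number of closed intervals of
length `ε` needed to cover `Z ⊆ ℝ`. -/
noncomputable def intervalCoveringNumber (Z : Set ℝ) (ε : ℝ) : ℕ :=
  sInf { n : ℕ | ∃ c : Fin n → ℝ, Z ⊆ ⋃ i, Set.Icc (c i) (c i + ε) }

/-- `ωd d Z = sup_{ε > 0} ε · (M(Z,ε) - d)`. -/
noncomputable def ωd (d : ℕ) (Z : Set ℝ) : ℝ :=
  sSup { t : ℝ | ∃ ε : ℝ, 0 < ε ∧ t = ε * ((intervalCoveringNumber Z ε : ℝ) - d) }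

open Polynomial Polynomial.Chebyshev in
lemma cheb_lagrange (d : ℕ) (y : ℝ) :
    (T ℝ (d : ℤ)).eval y = ∑ i ∈ Finset.range (d + 1),
      ∏ j ∈ (Finset.range (d + 1)).erase i, ((y - node d j) / |node d i - node d j|) := by
  have hdeg : (T ℝ (d : ℤ)).degree < (Finset.range (d + 1)).card := by
    rw [degree_T, Finset.card_range, Int.natAbs_natCast]
    exact_mod_cast Nat.lt_succ_self d
  have h := congrArg (Polynomial.eval y)
    (Lagrange.eq_interpolate (strictAntiOn_node d).injOn hdeg)
  rw [h, Lagrange.interpolate_apply, eval_finsetSum]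
  refine Finset.sum_congr rfl fun i hi => ?_
  have hi' : i ≤ d := by simpa [Nat.lt_succ_iff] using hi
  have hpos := zero_lt_prod_node_sub_node hi'
  rw [eval_mul, eval_C, eval_T_real_node (by simpa using hi'), Lagrange.basis, eval_prod,
    Finset.prod_div_distrib, ← Finset.abs_prod]
  simp only [Lagrange.basisDivisor, eval_mul, eval_C, eval_sub, eval_X]
  rw [Finset.prod_mul_distrib, Finset.prod_inv_distrib]
  set D := ∏ j ∈ (Finset.range (d + 1)).erase i, (node d i - node d j) with hD
  have habs : |D| = (-1) ^ i * D := by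
    rw [← abs_of_pos hpos, abs_mul, abs_neg_one_pow, one_mul]
  have hD0 : D ≠ 0 := by
    intro h0
    rw [h0] at hpos
    simp at hpos
  rw [habs]
  have h1 : ((-1 : ℝ) ^ i) * (-1) ^ i = 1 := by rw [← mul_pow]; simp
  have h2 : ((-1 : ℝ) ^ i) ≠ 0 := by positivity
  field_simp
  linear_combination (∏ j ∈ (Finset.range (d + 1)).erase i, (y - node d j)) * h1

open Polynomial Polynomial.Chebyshev in
lemma cheb_mono (d : ℕ) {x y : ℝ} (hx : 1 ≤ x) (hxy : x ≤ y) :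
    (T ℝ (d : ℤ)).eval x ≤ (T ℝ (d : ℤ)).eval y := by
  rw [cheb_lagrange, cheb_lagrange]
  refine Finset.sum_le_sum fun i _ => Finset.prod_le_prod (fun j _ => ?_) (fun j _ => ?_)
  · have := (node_mem_Icc (n := d) (i := j)).2
    exact div_nonneg (by linarith) (abs_nonneg _)
  · gcongr

open Polynomial Polynomial.Chebyshev in
lemma remez_points (d : ℕ) (P : ℝ[X]) (hP : P.natDegree ≤ d) (M x0 L s : ℝ)
    (hM : 0 ≤ M) (hs : 0 < s) (v : ℕ → ℝ) (hv : ∀ i ≤ d, |P.eval (v i)| ≤ M)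
    (h1 : ∀ i ≤ d, |x0 - v i| ≤ L - s * (node d i + 1) / 2)
    (h2 : ∀ i ≤ d, ∀ j ≤ d, |s * (node d i + 1) / 2 - s * (node d j + 1) / 2| ≤ |v i - v j|) :
    |P.eval x0| ≤ (T ℝ (d : ℤ)).eval (2 * L / s - 1) * M := by
  have hnode : ∀ i ≤ d, ∀ j ≤ d, i ≠ j → 0 < |node d i - node d j| := by
    intro i hi j hj hij
    rw [abs_pos, sub_ne_zero]
    intro h
    exact hij ((strictAntiOn_node d).injOn (by simpa [Nat.lt_succ_iff] using hi)
      (by simpa [Nat.lt_succ_iff] using hj) h)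
  have hdiff : ∀ i ≤ d, ∀ j ≤ d, s / 2 * |node d i - node d j| ≤ |v i - v j| := by
    intro i hi j hj
    refine le_trans (le_of_eq ?_) (h2 i hi j hj)
    rw [← abs_of_pos (half_pos hs), ← abs_mul]
    congr 1
    ring
  have hinj : Set.InjOn v (Finset.range (d + 1)) := by
    intro i hi j hj hij
    by_contra hne
    have hi' : i ≤ d := by simpa [Nat.lt_succ_iff] using hi
    have hj' : j ≤ d := by simpa [Nat.lt_succ_iff] using hj
    have a := hnode i hi' j hj' hne
    have b := hdiff i hi' j hj'
    rw [hij, sub_self, abs_zero] at b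
    have : 0 < s / 2 * |node d i - node d j| := by positivity
    linarith
  have hdeg : P.degree < (Finset.range (d + 1)).card := by
    rw [Finset.card_range]
    refine lt_of_le_of_lt Polynomial.degree_le_natDegree ?_
    exact_mod_cast Nat.lt_succ_of_le hP
  have h := congrArg (Polynomial.eval x0) (Lagrange.eq_interpolate hinj hdeg)
  rw [h, Lagrange.interpolate_apply, eval_finsetSum, cheb_lagrange, Finset.sum_mul]
  refine (Finset.abs_sum_le_sum_abs _ _).trans (Finset.sum_le_sum fun i hi => ?_)
  have hi' : i ≤ d := by simpa [Nat.lt_succ_iff] using hi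
  rw [eval_mul, eval_C, abs_mul, mul_comm]
  refine mul_le_mul ?_ (hv i hi') (abs_nonneg _) ?_
  · rw [Lagrange.basis, eval_prod, Finset.abs_prod]
    refine Finset.prod_le_prod (fun j _ => abs_nonneg _) fun j hj => ?_
    have hj' : j ≤ d := by
      have := (Finset.mem_erase.mp hj).2
      simpa [Nat.lt_succ_iff] using this
    have hij : i ≠ j := fun h => (Finset.mem_erase.mp hj).1 h.symm
    have hp := hnode i hi' j hj' hij
    have hd2 := hdiff i hi' j hj'
    simp only [Lagrange.basisDivisor, eval_mul, eval_C, eval_sub, eval_X]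
    rw [abs_mul, abs_inv, inv_mul_eq_div]
    have e : (2 * L / s - 1 - node d j) / |node d i - node d j| =
        (L - s * (node d j + 1) / 2) / (s / 2 * |node d i - node d j|) := by
      field_simp
      ring
    rw [e]
    have := h1 j hj'
    have h0 : 0 ≤ |x0 - v j| := abs_nonneg _
    exact div_le_div₀ (by linarith) this (by positivity) hd2
  · refine Finset.prod_nonneg fun j hj => ?_
    have hj' : j ≤ d := by
      have := (Finset.mem_erase.mp hj).2
      simpa [Nat.lt_succ_iff] using this
    refine div_nonneg ?_ (abs_nonneg _)
    have := (abs_nonneg _).trans (h1 j hj')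
    have e : 2 * L / s - 1 - node d j = (L - s * (node d j + 1) / 2) / (s / 2) := by
      field_simp
      ring
    rw [e]
    positivity

open MeasureTheory in
lemma exists_points (V : Set ℝ) (hV : IsCompact V) (a b : ℝ) (hab : V ⊆ Set.Icc a b)
    (hs : 0 < volume.real V) :
    ∃ t : ℝ → ℝ, ∀ y ∈ Set.Icc 0 (volume.real V), t y ∈ V ∧ y ≤ t y - a ∧
      volume.real V - y ≤ b - t y ∧
      ∀ y' ∈ Set.Icc 0 (volume.real V), |y - y'| ≤ |t y - t y'| := by
  set g : ℝ → ℝ := fun x => volume.real (V ∩ Set.Iic x) with hg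
  have hfin : volume V ≠ ⊤ := hV.measure_lt_top.ne
  have hfin' : ∀ x, volume (V ∩ Set.Iic x) ≠ ⊤ := fun x =>
    ne_top_of_le_ne_top hfin (measure_mono Set.inter_subset_left)
  have hmono : Monotone g := fun x x' hx =>
    measureReal_mono (Set.inter_subset_inter_right _ (Set.Iic_subset_Iic.2 hx)) (hfin' x')
  have hlip : ∀ x x', x ≤ x' → g x' ≤ g x + (x' - x) := by
    intro x x' hx
    have hsub : V ∩ Set.Iic x' ⊆ (V ∩ Set.Iic x) ∪ Set.Ioc x x' := by
      rintro z ⟨hz, hz'⟩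
      by_cases h : z ≤ x
      · exact Or.inl ⟨hz, h⟩
      · exact Or.inr ⟨not_le.1 h, hz'⟩
    have h1 : g x' ≤ volume.real ((V ∩ Set.Iic x) ∪ Set.Ioc x x') :=
      measureReal_mono hsub (by
        refine (measure_union_lt_top (hfin' x).lt_top ?_).ne
        simp)
    refine h1.trans ((measureReal_union_le _ _).trans ?_)
    simp [hg, hx]
  have hlip' : ∀ x x', |g x - g x'| ≤ |x - x'| := by
    intro x x'
    rcases le_total x x' with h | h
    · rw [abs_sub_comm, abs_sub_comm x, abs_of_nonneg (sub_nonneg.2 h),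
        abs_of_nonneg (sub_nonneg.2 (hmono h))]
      linarith [hlip x x' h]
    · rw [abs_of_nonneg (sub_nonneg.2 h), abs_of_nonneg (sub_nonneg.2 (hmono h))]
      linarith [hlip x' x h]
  have hcont : Continuous g := by
    have : LipschitzWith 1 g := LipschitzWith.of_dist_le_mul fun x y => by
      simpa [Real.dist_eq] using hlip' x y
    exact this.continuous
  have hne : V.Nonempty := by
    by_contra h
    rw [Set.not_nonempty_iff_eq_empty] at h
    simp [h] at hs
  have hga : ∀ x, V ∩ Set.Iio x = ∅ → g x = 0 := by
    intro x hx
    have hsub : V ∩ Set.Iic x ⊆ {x} := by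
      rintro z ⟨hz, hz'⟩
      by_contra h
      have : z ∈ V ∩ Set.Iio x := ⟨hz, lt_of_le_of_ne hz' h⟩
      rw [hx] at this
      exact this
    have : volume (V ∩ Set.Iic x) = 0 := measure_mono_null hsub (by simp)
    simp [hg, Measure.real, this]
  have hg0 : g a = 0 := by
    apply hga
    ext z
    simp only [Set.mem_inter_iff, Set.mem_Iio, Set.mem_empty_iff_false, iff_false, not_and, not_lt]
    exact fun hz => (hab hz).1
  have hgb : g b = volume.real V := by
    have : V ∩ Set.Iic b = V := Set.inter_eq_left.2 fun z hz => (hab hz).2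
    simp [hg, this]
  obtain ⟨w, hw⟩ := hne
  have hle : a ≤ b := (hab hw).1.trans (hab hw).2
  have key : ∀ y ∈ Set.Icc 0 (volume.real V), ∃ t ∈ V, g t = y := by
    intro y hy
    have : y ∈ g '' Set.Icc a b :=
      intermediate_value_Icc hle hcont.continuousOn (by rw [hg0, hgb]; exact hy)
    obtain ⟨T, hT, hTy⟩ := this
    by_cases hn : (V ∩ Set.Iic T).Nonempty
    · obtain ⟨t, ht, hmax⟩ := (hV.inter_right isClosed_Iic).exists_isGreatest hn
      refine ⟨t, ht.1, ?_⟩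
      rw [← hTy]
      have : V ∩ Set.Iic t = V ∩ Set.Iic T := by
        ext z
        constructor
        · rintro ⟨hz, hz'⟩
          exact ⟨hz, Set.mem_Iic.2 (le_trans (Set.mem_Iic.1 hz') (Set.mem_Iic.1 ht.2))⟩
        · rintro hz
          exact ⟨hz.1, hmax hz⟩
      simp [hg, this]
    · rw [Set.not_nonempty_iff_eq_empty] at hn
      have hy0 : y = 0 := by rw [← hTy]; simp [hg, hn]
      obtain ⟨t, ht, hmin⟩ := hV.exists_isLeast ⟨w, hw⟩
      refine ⟨t, ht, ?_⟩
      rw [hy0]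
      apply hga
      ext z
      simp only [Set.mem_inter_iff, Set.mem_Iio, Set.mem_empty_iff_false, iff_false, not_and,
        not_lt]
      exact fun hz => hmin hz
  choose! t ht htg using key
  refine ⟨t, fun y hy => ⟨ht y hy, ?_, ?_, fun y' hy' => ?_⟩⟩
  · have := hlip a (t y) (hab (ht y hy)).1
    rw [hg0, htg y hy] at this
    linarith
  · have := hlip (t y) b (hab (ht y hy)).2
    rw [hgb, htg y hy] at this
    linarith
  · have := hlip' (t y) (t y')
    rwa [htg y hy, htg y' hy'] at this

lemma greedy (V : Set ℝ) (hV : IsCompact V) (ε : ℝ) (hε : 0 < ε) (n : ℕ) : ∀ a : ℝ,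
    (∃ c : Fin n → ℝ, V ∩ Set.Ici a ⊆ ⋃ i, Set.Icc (c i) (c i + ε)) ∨
    (∃ S : Finset ℝ, S.card = n + 1 ∧ (∀ x ∈ S, x ∈ V ∧ a ≤ x) ∧
      ∀ x ∈ S, ∀ y ∈ S, x < y → x + ε ≤ y) := by
  induction n with
  | zero =>
    intro a
    by_cases h : (V ∩ Set.Ici a).Nonempty
    · obtain ⟨x, hx⟩ := h
      refine Or.inr ⟨{x}, by simp, ?_, ?_⟩
      · intro y hy
        rw [Finset.mem_singleton] at hy
        subst hy
        exact ⟨hx.1, hx.2⟩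
      · intro y hy w hw hlt
        rw [Finset.mem_singleton] at hy hw
        subst hy hw
        exact absurd hlt (lt_irrefl _)
    · rw [Set.not_nonempty_iff_eq_empty] at h
      exact Or.inl ⟨fun _ => 0, by simp [h]⟩
  | succ n ih =>
    intro a
    by_cases h : (V ∩ Set.Ici a).Nonempty
    · obtain ⟨x, hx, hmin⟩ := (hV.inter_right isClosed_Ici).exists_isLeast h
      rcases ih (x + ε) with ⟨c, hc⟩ | ⟨S, hS, h1, h2⟩
      · refine Or.inl ⟨Fin.cons x c, ?_⟩
        intro y hy
        have hxy : x ≤ y := hmin hy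
        rw [Set.mem_iUnion]
        by_cases hle : y ≤ x + ε
        · exact ⟨0, by simpa using ⟨hxy, hle⟩⟩
        · have := hc ⟨hy.1, (not_le.1 hle).le⟩
          rw [Set.mem_iUnion] at this
          obtain ⟨i, hi⟩ := this
          exact ⟨i.succ, by simpa using hi⟩
      · have hxS : x ∉ S := fun hx' => by linarith [(h1 x hx').2]
        refine Or.inr ⟨insert x S, by rw [Finset.card_insert_of_notMem hxS, hS], ?_, ?_⟩
        · intro y hy
          rcases Finset.mem_insert.1 hy with rfl | hy
          · exact ⟨hx.1, hx.2⟩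
          · have hxa : a ≤ x := hx.2
            exact ⟨(h1 y hy).1, by linarith [(h1 y hy).2]⟩
        · intro y hy w hw hlt
          rcases Finset.mem_insert.1 hy with hyx | hyS
          · rcases Finset.mem_insert.1 hw with hwx | hwS
            · rw [hyx, hwx] at hlt
              exact absurd hlt (lt_irrefl _)
            · rw [hyx]
              exact (h1 w hwS).2
          · rcases Finset.mem_insert.1 hw with hwx | hwS
            · linarith [(h1 y hyS).2]
            · exact h2 y hyS w hwS hlt
    · rw [Set.not_nonempty_iff_eq_empty] at h
      exact Or.inl ⟨fun _ => 0, by simp [h]⟩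

lemma count_roots (f : Polynomial ℝ) (z : ℝ → ℝ) (u : ℝ) (hu : 0 < f.eval u) (S : Finset ℝ) :
    (∀ x ∈ S, u < x ∧ f.eval x < 0 ∧ x < z x ∧ 0 < f.eval (z x)) →
    (∀ x ∈ S, ∀ y ∈ S, x < y → z x < y) →
    ∃ R : Finset ℝ, ∃ w : ℝ, R.card = 2 * S.card ∧ (∀ r ∈ R, f.IsRoot r ∧ r < w) ∧
      0 < f.eval w ∧ (w = u ∨ ∃ x ∈ S, w = z x) := by
  induction S using Finset.induction_on_max with
  | empty =>
    intro _ _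
    exact ⟨∅, u, by simp, by simp, hu, Or.inl rfl⟩
  | insert a s hlt ih =>
    intro h1 h2
    obtain ⟨R, w, hc, hR, hw, hor⟩ := ih (fun x hx => h1 x (Finset.mem_insert_of_mem hx))
      (fun x hx y hy => h2 x (Finset.mem_insert_of_mem hx) y (Finset.mem_insert_of_mem hy))
    obtain ⟨hua, hfa, haz, hfz⟩ := h1 a (Finset.mem_insert_self _ _)
    have hwa : w < a := by
      rcases hor with rfl | ⟨x, hx, rfl⟩
      · exact hua
      · exact h2 x (Finset.mem_insert_of_mem hx) a (Finset.mem_insert_self _ _) (hlt x hx)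
    obtain ⟨p, hp, hp0⟩ : (0 : ℝ) ∈ (fun x => f.eval x) '' Set.Ioo w a :=
      intermediate_value_Ioo' hwa.le f.continuous.continuousOn ⟨hfa, hw⟩
    obtain ⟨q, hq, hq0⟩ : (0 : ℝ) ∈ (fun x => f.eval x) '' Set.Ioo a (z a) :=
      intermediate_value_Ioo haz.le f.continuous.continuousOn ⟨hfa, hfz⟩
    have hpR : p ∉ R := fun h => lt_asymm (hR p h).2 hp.1
    have hqR : q ∉ insert p R := by
      rw [Finset.mem_insert, not_or]
      refine ⟨ne_of_gt (hp.2.trans hq.1), fun h => ?_⟩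
      linarith [(hR q h).2, hq.1]
    refine ⟨insert q (insert p R), z a, ?_, ?_, hfz, Or.inr ⟨a, Finset.mem_insert_self _ _, rfl⟩⟩
    · rw [Finset.card_insert_of_notMem hqR, Finset.card_insert_of_notMem hpR,
        Finset.card_insert_of_notMem (fun h => lt_irrefl _ (hlt a h)), hc]
      ring
    · intro r hr
      rw [Finset.mem_insert, Finset.mem_insert] at hr
      rcases hr with rfl | rfl | hr
      · exact ⟨hq0, hq.2⟩
      · exact ⟨hp0, by linarith [hp.2]⟩
      · exact ⟨(hR r hr).1, by linarith [(hR r hr).2]⟩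

lemma count_bad (d : ℕ) (hd : 0 < d) (P : Polynomial ℝ) (hP : P.natDegree = d) (M : ℝ)
    (hM : 0 ≤ M) (z : ℝ → ℝ) (S : Finset ℝ)
    (h1 : ∀ x ∈ S, |P.eval x| ≤ M ∧ x < z x ∧ M < |P.eval (z x)|)
    (h2 : ∀ x ∈ S, ∀ y ∈ S, x < y → z x < y) : S.card ≤ d := by
  have hdeg : 0 < P.degree := Polynomial.natDegree_pos_iff_degree_pos.1 (hP ▸ hd)
  obtain ⟨N, hMN, hN⟩ : ∃ N, M < N ∧ ∀ x ∈ S, N < |P.eval (z x)| := by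
    clear h2
    induction S using Finset.induction_on with
    | empty => exact ⟨M + 1, by linarith, by simp⟩
    | insert a s _ ih =>
      obtain ⟨N, hN, h⟩ := ih (fun x hx => h1 x (Finset.mem_insert_of_mem hx))
      obtain ⟨K, hK1, hK2⟩ := exists_between (lt_min hN (h1 a (Finset.mem_insert_self _ _)).2.2)
      refine ⟨K, hK1, fun x hx => ?_⟩
      rcases Finset.mem_insert.1 hx with rfl | hx
      · exact hK2.trans_le (min_le_right _ _)
      · exact (hK2.trans_le (min_le_left _ _)).trans (h x hx)
  obtain ⟨u, hu, huS⟩ : ∃ u, N < |P.eval u| ∧ ∀ x ∈ S, u < x := by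
    have e1 := (P.abs_tendsto_atBot hdeg).eventually_gt_atTop N
    have e2 : ∀ᶠ u in Filter.atBot, ∀ x ∈ S, u < x :=
      (Finset.eventually_all S).2 fun x _ => Filter.eventually_lt_atBot x
    exact (e1.and e2).exists
  set f : Polynomial ℝ := P ^ 2 - Polynomial.C (N ^ 2) with hf
  have hN0 : 0 ≤ N := by linarith
  have hev : ∀ x, f.eval x = |P.eval x| ^ 2 - N ^ 2 := fun x => by simp [hf]
  have hfpos : ∀ x, N < |P.eval x| → 0 < f.eval x := fun x hx => by
    rw [hev]; nlinarith
  have hfneg : ∀ x, |P.eval x| ≤ M → f.eval x < 0 := fun x hx => by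
    rw [hev]; nlinarith [abs_nonneg (P.eval x)]
  obtain ⟨R, w, hc, hR, -⟩ := count_roots f z u (hfpos u hu) S
    (fun x hx => ⟨huS x hx, hfneg x (h1 x hx).1, (h1 x hx).2.1, hfpos _ (hN x hx)⟩) h2
  have hf0 : f ≠ 0 := fun h => by
    have := hfpos u hu
    simp [h] at this
  have hfd : f.natDegree ≤ 2 * d := by
    rw [hf, Polynomial.natDegree_sub_C, ← hP]
    exact Polynomial.natDegree_pow_le
  have : R.card ≤ f.natDegree := by
    refine Polynomial.card_le_degree_of_subset_roots ?_
    intro r hr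
    exact (Polynomial.mem_roots hf0).2 (hR r hr).1
  omega

open Polynomial Polynomial.Chebyshev MeasureTheory in
lemma remez_side (d : ℕ) (P : ℝ[X]) (hP : P.natDegree ≤ d) (M a b : ℝ) (hM : 0 ≤ M)
    (V : Set ℝ) (hV : IsCompact V) (hab : V ⊆ Set.Icc a b) (hs : 0 < volume.real V)
    (hPV : ∀ x ∈ V, |P.eval x| ≤ M) (x0 : ℝ) (hx0 : x0 = a ∨ x0 = b) :
    |P.eval x0| ≤ (T ℝ (d : ℤ)).eval (2 * (b - a) / volume.real V - 1) * M := by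
  obtain ⟨t, ht⟩ := exists_points V hV a b hab hs
  set s := volume.real V
  have hy : ∀ i, s * (node d i + 1) / 2 ∈ Set.Icc 0 s := fun i => by
    have := (node_mem_Icc (n := d) (i := i))
    constructor
    · have : 0 ≤ s * (node d i + 1) := mul_nonneg hs.le (by linarith [this.1])
      linarith
    · nlinarith [this.2]
  rcases hx0 with rfl | rfl
  · have hy' : ∀ i, s - s * (node d i + 1) / 2 ∈ Set.Icc 0 s := fun i =>
      ⟨by linarith [(hy i).2], by linarith [(hy i).1]⟩
    refine remez_points d P hP M x0 (b - x0) s hM hs (fun i => t (s - s * (node d i + 1) / 2))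
      (fun i _ => hPV _ (ht _ (hy' i)).1) (fun i _ => ?_) (fun i _ j _ => ?_)
    · obtain ⟨h1, h2, h3, -⟩ := ht _ (hy' i)
      rw [abs_sub_comm, abs_of_nonneg (by linarith [(hab h1).1])]
      linarith
    · have := (ht _ (hy' i)).2.2.2 _ (hy' j)
      refine le_trans (le_of_eq ?_) this
      rw [abs_sub_comm]
      congr 1
      ring
  · refine remez_points d P hP M x0 (x0 - a) s hM hs (fun i => t (s * (node d i + 1) / 2))
      (fun i _ => hPV _ (ht _ (hy i)).1) (fun i _ => ?_)
      (fun i _ j _ => (ht _ (hy i)).2.2.2 _ (hy j))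
    obtain ⟨h1, h2, h3, -⟩ := ht _ (hy i)
    rw [abs_of_nonneg (by linarith [(hab h1).2])]
    linarith

open Polynomial Polynomial.Chebyshev MeasureTheory in
lemma remez_classical (d : ℕ) (P : ℝ[X]) (hP : P.natDegree ≤ d) (M : ℝ) (hM : 0 ≤ M)
    (V : Set ℝ) (hV : IsCompact V) (hab : V ⊆ Set.Icc (-1) 1) (ω : ℝ) (hω : 0 < ω)
    (hs : ω ≤ volume.real V)
    (hPV : ∀ x ∈ V, |P.eval x| ≤ M) (x : ℝ) (hx : x ∈ Set.Icc (-1 : ℝ) 1) :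
    |P.eval x| ≤ (T ℝ (d : ℤ)).eval ((4 - ω) / ω) * M := by
  have key : ∀ a b : ℝ, a ≤ b → (x = a ∨ x = b) → 0 < volume.real (V ∩ Set.Icc a b) →
      ω * (b - a) / 2 ≤ volume.real (V ∩ Set.Icc a b) →
      |P.eval x| ≤ (T ℝ (d : ℤ)).eval ((4 - ω) / ω) * M := by
    intro a b hle hor hpos hden
    refine (remez_side d P hP M a b hM (V ∩ Set.Icc a b) (hV.inter_right isClosed_Icc)
      Set.inter_subset_right hpos (fun y hy => hPV y hy.1) x hor).trans ?_
    have hup : volume.real (V ∩ Set.Icc a b) ≤ b - a := by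
      have : volume.real (V ∩ Set.Icc a b) ≤ volume.real (Set.Icc a b) :=
        measureReal_mono Set.inter_subset_right (by simp)
      simpa [hle] using this
    refine mul_le_mul_of_nonneg_right (cheb_mono d ?_ ?_) hM
    · rw [le_sub_iff_add_le, le_div_iff₀ hpos]
      linarith
    · rw [sub_le_iff_le_add, div_add_one hω.ne', div_le_div_iff₀ hpos hω]
      nlinarith
  have hsum : volume.real V ≤ volume.real (V ∩ Set.Icc (-1) x) + volume.real (V ∩ Set.Icc x 1) := by
    refine le_trans (measureReal_mono ?_ ?_) (measureReal_union_le _ _)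
    · intro y hy
      have := hab hy
      rcases le_total y x with h | h
      · exact Or.inl ⟨hy, this.1, h⟩
      · exact Or.inr ⟨hy, h, this.2⟩
    · refine ne_top_of_le_ne_top hV.measure_lt_top.ne (measure_mono ?_)
      exact Set.union_subset Set.inter_subset_left Set.inter_subset_left
  have n1 : 0 ≤ volume.real (V ∩ Set.Icc (-1) x) := measureReal_nonneg
  have n2 : 0 ≤ volume.real (V ∩ Set.Icc x 1) := measureReal_nonneg
  obtain ⟨hx1, hx2⟩ := hx
  by_cases h : 0 < volume.real (V ∩ Set.Icc (-1) x) ∧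
      ω * (x - -1) / 2 ≤ volume.real (V ∩ Set.Icc (-1) x)
  · exact key (-1) x hx1 (Or.inr rfl) h.1 h.2
  · have h2 : ω * (1 - x) / 2 ≤ volume.real (V ∩ Set.Icc x 1) ∧
        0 < volume.real (V ∩ Set.Icc x 1) := by
      rcases n1.eq_or_lt with h0 | h0
      · rw [← h0] at hsum
        constructor <;> nlinarith
      · have h' : volume.real (V ∩ Set.Icc (-1) x) < ω * (x - -1) / 2 := by
          by_contra hc
          exact h ⟨h0, not_lt.1 hc⟩
        constructor <;> nlinarith
    exact key x 1 hx2 (Or.inl rfl) h2.2 h2.1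

open MeasureTheory in
lemma packing_bound (d : ℕ) (hd : 0 < d) (P : Polynomial ℝ) (hP : P.natDegree = d) (M : ℝ)
    (hM : 0 ≤ M) (V : Set ℝ) (hVdef : V = {x ∈ Set.Icc (-1 : ℝ) 1 | |P.eval x| ≤ M})
    (ε : ℝ) (hε : 0 < ε) (S : Finset ℝ) (hSV : ∀ x ∈ S, x ∈ V)
    (hsep : ∀ x ∈ S, ∀ y ∈ S, x < y → x + ε ≤ y) :
    (S.card : ℝ) * ε ≤ d * ε + volume.real V := by
  classical
  have hdeg : 0 < P.degree := Polynomial.natDegree_pos_iff_degree_pos.1 (hP ▸ hd)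
  set G := S.filter (fun x => Set.Ico x (x + ε) ⊆ V) with hG
  set B := S.filter (fun x => ¬ Set.Ico x (x + ε) ⊆ V) with hB
  have hcard : G.card + B.card = S.card := Finset.card_filter_add_card_filter_not _
  have hfin : volume V ≠ ⊤ := by
    refine ne_top_of_le_ne_top (b := volume (Set.Icc (-1 : ℝ) 1)) (by simp) (measure_mono ?_)
    rw [hVdef]
    exact Set.sep_subset _ _
  have hGc : (G.card : ℝ) * ε ≤ volume.real V := by
    have h1 : volume.real (⋃ x ∈ G, Set.Ico x (x + ε)) = ∑ x ∈ G, volume.real (Set.Ico x (x + ε)) := by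
      refine measureReal_biUnion_finset ?_ (fun _ _ => measurableSet_Ico) (fun _ _ => by simp)
      intro x hx y hy hxy
      have hxS := (Finset.mem_filter.1 hx).1
      have hyS := (Finset.mem_filter.1 hy).1
      refine Set.disjoint_left.2 fun w hw hw' => ?_
      rcases lt_or_gt_of_ne hxy with h | h
      · linarith [hsep x hxS y hyS h, hw.2, hw'.1]
      · linarith [hsep y hyS x hxS h, hw.1, hw'.2]
    have h2 : ∑ x ∈ G, volume.real (Set.Ico x (x + ε)) = G.card * ε := by
      have : ∀ x ∈ G, volume.real (Set.Ico x (x + ε)) = ε := fun x _ => by simp [hε.le]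
      rw [Finset.sum_congr rfl this]
      simp
    rw [← h2, ← h1]
    refine measureReal_mono ?_ hfin
    exact Set.iUnion₂_subset fun x hx => (Finset.mem_filter.1 hx).2
  have hBc : B.card ≤ d := by
    have hz : ∀ x ∈ B, ∃ z, x < z ∧ M < |P.eval z| ∧ ∀ y ∈ S, x < y → z < y := by
      intro x hx
      obtain ⟨hxS, hnot⟩ := Finset.mem_filter.1 hx
      have hxV := hSV x hxS
      obtain ⟨z, hz, hzV⟩ := Set.not_subset.1 hnot
      have hxz : x < z := by
        refine lt_of_le_of_ne hz.1 ?_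
        rintro rfl
        exact hzV hxV
      have hxV' := hxV
      rw [hVdef] at hxV' hzV
      by_cases hz1 : z ≤ 1
      · refine ⟨z, hxz, ?_, fun y hy hxy => hz.2.trans_le (hsep x hxS y hy hxy)⟩
        by_contra hc
        exact hzV ⟨⟨hxV'.1.1.trans hz.1, hz1⟩, not_lt.1 hc⟩
      · have e1 := (P.abs_tendsto_atTop hdeg).eventually_gt_atTop M
        obtain ⟨w, hw1, hw2⟩ := (e1.and (Filter.eventually_gt_atTop x)).exists
        refine ⟨w, hw2, hw1, fun y hy hxy => ?_⟩
        exfalso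
        have hyV := hSV y hy
        rw [hVdef] at hyV
        linarith [hyV.1.2, hsep x hxS y hy hxy, hz.2]
    choose! z hz1 hz2 hz3 using hz
    refine count_bad d hd P hP M hM z B (fun x hx => ⟨?_, hz1 x hx, hz2 x hx⟩)
      (fun x hx y hy => hz3 x hx y (Finset.mem_filter.1 hy).1)
    have := hSV x (Finset.mem_filter.1 hx).1
    rw [hVdef] at this
    exact this.2
  have hBc' : (B.card : ℝ) ≤ d := by exact_mod_cast hBc
  have : (S.card : ℝ) = G.card + B.card := by exact_mod_cast hcard.symm
  rw [this]
  nlinarith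

open MeasureTheory in
lemma omega_le (d : ℕ) (hd : 0 < d) (P : Polynomial ℝ) (hP : P.natDegree = d) (M : ℝ)
    (hM : 0 ≤ M) (V : Set ℝ) (hVdef : V = {x ∈ Set.Icc (-1 : ℝ) 1 | |P.eval x| ≤ M})
    (hV : IsCompact V) (Z : Set ℝ) (hZ : Z ⊆ V) : ωd d Z ≤ volume.real V := by
  refine csSup_le ⟨_, 1, one_pos, rfl⟩ ?_
  rintro _ ⟨ε, hε, rfl⟩
  set s := volume.real V with hs
  have hs0 : 0 ≤ s := measureReal_nonneg
  have hq : 0 ≤ d + s / ε := by positivity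
  have hcov : intervalCoveringNumber Z ε ≤ ⌊d + s / ε⌋₊ := by
    refine Nat.sInf_le ?_
    rcases greedy V hV ε hε ⌊d + s / ε⌋₊ (-1) with ⟨c, hc⟩ | ⟨S, hS, h1, h2⟩
    · refine ⟨c, fun z hz => hc ⟨hZ hz, ?_⟩⟩
      have := hZ hz
      rw [hVdef] at this
      exact this.1.1
    · exfalso
      have hb := packing_bound d hd P hP M hM V hVdef ε hε S (fun x hx => (h1 x hx).1) h2
      have hlt := Nat.lt_floor_add_one (d + s / ε)
      rw [hS] at hb
      push_cast at hb
      have : (d + s / ε) * ε < (⌊d + s / ε⌋₊ + 1) * ε := mul_lt_mul_of_pos_right hlt hε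
      rw [add_mul, div_mul_cancel₀ _ hε.ne'] at this
      linarith
  have h1 : (intervalCoveringNumber Z ε : ℝ) ≤ d + s / ε :=
    le_trans (by exact_mod_cast hcov) (Nat.floor_le hq)
  calc ε * ((intervalCoveringNumber Z ε : ℝ) - d) ≤ ε * (s / ε) := by
        apply mul_le_mul_of_nonneg_left _ hε.le
        linarith
    _ = s := by field_simp

theorem remez_omega (d : ℕ) (hd : 0 < d) (P : Polynomial ℝ) (hP : P.natDegree = d)
    (Z : Set ℝ) (hZ : Z ⊆ Set.Icc (-1 : ℝ) 1) (ω : ℝ) (hω : ω = ωd d Z)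
    (hωpos : 0 < ω) (hωle : ω ≤ 2) :
    sSup ((fun x => |P.eval x|) '' Set.Icc (-1 : ℝ) 1) ≤
      (Polynomial.Chebyshev.T ℝ (d : ℤ)).eval ((4 - ω) / ω) *
        sSup ((fun x => |P.eval x|) '' Z) := by
  set M := sSup ((fun x => |P.eval x|) '' Z) with hMdef
  have hcont : Continuous fun x => |P.eval x| := P.continuous.abs
  have hbdd : BddAbove ((fun x => |P.eval x|) '' Z) :=
    (isCompact_Icc.bddAbove_image hcont.continuousOn).mono (Set.image_mono hZ)
  have hM : 0 ≤ M := Real.sSup_nonneg (by rintro _ ⟨x, _, rfl⟩; exact abs_nonneg _)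
  set V : Set ℝ := {x ∈ Set.Icc (-1 : ℝ) 1 | |P.eval x| ≤ M} with hVdef
  have hV : IsCompact V := isCompact_Icc.inter_right (isClosed_le hcont continuous_const)
  have hZV : Z ⊆ V := fun z hz => ⟨hZ hz, le_csSup hbdd ⟨z, hz, rfl⟩⟩
  have hle := omega_le d hd P hP M hM V hVdef hV Z hZV
  rw [← hω] at hle
  refine csSup_le ⟨_, 0, by norm_num, rfl⟩ ?_
  rintro _ ⟨x, hx, rfl⟩
  exact remez_classical d P hP.le M hM V hV (fun y hy => hy.1) ω hωpos hle (fun y hy => hy.2) x hx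
end
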